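/- arXiv:2602.23819 — 2 statements merged into one kernel-verified Lean document; each statement's English description precedes it below -/
import Mathlib

section
/- Let Γ be a Coxeter graph with vertex set S and let X ⊆ S. The natural homomorphism ι_X : W[Γ_X] → W[Γ] mapping x to x for every x ∈ X is injective, and it preserves word length: ℓ_X(w) = ℓ_S(ι_X(w)) for every w ∈ W[Γ_X], where ℓ_X is word length in W[Γ_X] with respect to X and ℓ_S is word length in W[Γ] with respect to S. -/
/-- The restriction of a Coxeter matrix to a subset of its index set (the Coxeter matrix of the
full Coxeter subgraph `Γ_X`). -/
def CoxeterMatrix.restrict {S : Type*} (M : CoxeterMatrix S) (X : Set S) : CoxeterMatrix X where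
  M := fun x y => M x y
  isSymm := Matrix.IsSymm.ext fun x y => M.isSymm.apply x y
  diagonal := fun x => M.diagonal x
  off_diagonal := fun x y hxy => M.off_diagonal x y (fun h => hxy (Subtype.ext h))

namespace CoxeterSystem

open Real

/-- The coefficients of the roots of a rank-two Coxeter system of type `m` with respect to its
simple roots. -/
noncomputable def dihedralRootCoeff (m k : ℕ) : ℝ :=
  if m = 0 then k else sin (k * (π / m)) / sin (π / m)

theorem sin_pi_div_pos {m : ℕ} (hm : 2 ≤ m) : 0 < sin (π / m) := by
  have hm' : (2 : ℝ) ≤ m := by exact_mod_cast hm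
  apply sin_pos_of_pos_of_lt_pi
  · positivity
  · rw [div_lt_iff₀ (by linarith)]
    nlinarith [pi_pos]

theorem dihedralRootCoeff_zero (m : ℕ) : dihedralRootCoeff m 0 = 0 := by
  simp [dihedralRootCoeff]

theorem dihedralRootCoeff_one {m : ℕ} (hm : m ≠ 1) : dihedralRootCoeff m 1 = 1 := by
  by_cases h : m = 0
  · simp [dihedralRootCoeff, h]
  · have := (sin_pi_div_pos (m := m) (by omega)).ne'
    simp [dihedralRootCoeff, h, this]

theorem dihedralRootCoeff_add_two (m k : ℕ) :
    dihedralRootCoeff m (k + 2) =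
      2 * cos (π / m) * dihedralRootCoeff m (k + 1) - dihedralRootCoeff m k := by
  by_cases h : m = 0
  · simp only [dihedralRootCoeff, h]
    push_cast
    simp
    ring
  · simp only [dihedralRootCoeff, h, if_false]
    have h₁ : ((k + 2 : ℕ) : ℝ) * (π / m) = ((k + 1 : ℕ) : ℝ) * (π / m) + π / m := by
      push_cast; ring
    have h₂ : (k : ℝ) * (π / m) = ((k + 1 : ℕ) : ℝ) * (π / m) - π / m := by
      push_cast; ring
    rw [h₁, h₂, sin_add, sin_sub]
    ring

theorem dihedralRootCoeff_nonneg {m k : ℕ} (h : m = 0 ∨ k ≤ m) : 0 ≤ dihedralRootCoeff m k := by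
  by_cases hm : m = 0
  · simp [dihedralRootCoeff, hm]
  · have hk : (k : ℝ) ≤ m := by exact_mod_cast h.resolve_left hm
    have hm' : (1 : ℝ) ≤ m := by exact_mod_cast Nat.one_le_iff_ne_zero.2 hm
    simp only [dihedralRootCoeff, hm, if_false]
    apply div_nonneg <;> apply sin_nonneg_of_nonneg_of_le_pi
    · positivity
    · rw [← mul_div_assoc, div_le_iff₀ (by linarith)]
      nlinarith [pi_pos]
    · positivity
    · exact div_le_self pi_pos.le hm'

section Positivity

variable {B W V : Type*} [Group W] {M : CoxeterMatrix B} (cs : CoxeterSystem M W)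
  [AddCommGroup V] [Module ℝ V] (ρ : W →* V ≃ₗ[ℝ] V) (α : B → V)

theorem length_mul_wordProd_le (v : W) (ω : List B) :
    cs.length (v * cs.wordProd ω) ≤ cs.length v + ω.length :=
  (cs.length_mul_le _ _).trans (by gcongr; exact cs.length_wordProd_le ω)

theorem apply_wordProd_alternatingWord
    (hρ : ∀ i j, ρ (cs.simple i) (α j) = α j + (2 * cos (π / M i j)) • α i)
    {i j : B} (hij : i ≠ j) (k : ℕ) :
    ρ (cs.wordProd (alternatingWord i j k)) (α i) =
      if Even k then
        dihedralRootCoeff (M i j) (k + 1) • α i + dihedralRootCoeff (M i j) k • α j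
      else dihedralRootCoeff (M i j) k • α i + dihedralRootCoeff (M i j) (k + 1) • α j := by
  have hself (i : B) : ρ (cs.simple i) (α i) = -α i := by
    rw [hρ, M.diagonal]
    simp
    module
  induction k with
  | zero =>
    simp [alternatingWord, dihedralRootCoeff_zero, dihedralRootCoeff_one (M.off_diagonal i j hij)]
  | succ k ih =>
    rw [alternatingWord_succ', wordProd_cons, map_mul, LinearEquiv.mul_apply, ih]
    by_cases hk : Even k
    · simp only [hk, Nat.even_add_one, if_true, not_true, if_false, map_add, map_smul, hself, hρ,
        dihedralRootCoeff_add_two, M.symmetric j i]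
      module
    · simp only [hk, Nat.even_add_one, if_true, not_false_eq_true, if_false, map_add, map_smul,
        hself, hρ, dihedralRootCoeff_add_two]
      module

variable [PartialOrder V] [IsOrderedAddMonoid V] [PosSMulMono ℝ V]

/-- If `i` is not a right descent of `w`, then `w` sends the simple root of `i` to a nonnegative
vector. -/
theorem nonneg_apply_of_not_isRightDescent (hα : ∀ i, 0 ≤ α i)
    (hρ : ∀ i j, ρ (cs.simple i) (α j) = α j + (2 * cos (π / M i j)) • α i)
    {w : W} {i : B} (h : ¬ cs.IsRightDescent w i) : 0 ≤ ρ w (α i) := by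
  induction hn : cs.length w using Nat.strong_induction_on generalizing w i with
  | _ n ih =>
  subst hn
  by_cases hw : w = 1
  · simpa [hw] using hα i
  obtain ⟨j, hj⟩ := cs.exists_rightDescent_of_ne_one hw
  have hij : i ≠ j := by rintro rfl; exact h hj
  let D : ℕ → Prop := fun k ↦
    ∃ v, w = v * cs.wordProd (alternatingWord i j k) ∧ cs.length v + k = cs.length w
  have hD1 : D 1 := by
    refine ⟨w * cs.simple j, by simp [alternatingWord], ?_⟩
    exact cs.isRightDescent_iff.1 hj
  have hDpred (k : ℕ) (hk : D (k + 1)) : D k := by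
    obtain ⟨v, hv, hl⟩ := hk
    rw [alternatingWord_succ', wordProd_cons, ← mul_assoc] at hv
    set u := if Even k then j else i
    refine ⟨v * cs.simple u, hv, ?_⟩
    have h₁ := cs.length_mul_le v (cs.simple u)
    have h₂ := cs.length_mul_wordProd_le (v * cs.simple u) (alternatingWord i j k)
    rw [← hv, length_alternatingWord] at h₂
    rw [length_simple] at h₁
    omega
  have hDle {k l : ℕ} (hkl : k ≤ l) (hl : D l) : D k := by
    induction hkl with
    | refl => exact hl
    | step _ ih => exact ih (hDpred _ hl)
  have hDlt {k : ℕ} (hk : D k) : M i j = 0 ∨ k < M i j := by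
    by_contra! hcon
    obtain ⟨v, hv, hl⟩ := hDle hcon.2 hk
    have hbraid := cs.wordProd_braidWord_eq i j
    unfold braidWord at hbraid
    obtain ⟨m, hm⟩ := Nat.exists_eq_succ_of_ne_zero hcon.1
    rw [hbraid, M.symmetric j i, hm, alternatingWord_succ, wordProd_concat, ← mul_assoc] at hv
    have h₂ := cs.length_mul_wordProd_le v (alternatingWord i j m)
    rw [length_alternatingWord] at h₂
    apply h
    rw [IsRightDescent, hv, simple_mul_simple_cancel_right, ← hv]
    omega
  obtain ⟨k, hk, hkmax⟩ : ∃ k, D k ∧ ¬ D (k + 1) := by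
    by_contra! hcon
    have hall (k : ℕ) : D k := by
      induction k with
      | zero => exact hDpred 0 hD1
      | succ k ih => exact hcon k ih
    obtain ⟨v, -, hv⟩ := hall (cs.length w + 1)
    omega
  have hk0 : k ≠ 0 := by rintro rfl; exact hkmax hD1
  have hkM := hDlt hk
  obtain ⟨v, hv, hl⟩ := hk
  obtain ⟨l, rfl⟩ := Nat.exists_eq_succ_of_ne_zero hk0
  have hnext : ¬ cs.IsRightDescent v (if Even (l + 1) then j else i) := by
    intro hd
    apply hkmax
    refine ⟨v * cs.simple (if Even (l + 1) then j else i), ?_, ?_⟩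
    · rw [alternatingWord_succ', wordProd_cons, ← mul_assoc, simple_mul_simple_cancel_right]
      exact hv
    · rw [isRightDescent_iff] at hd
      omega
  have hprev : ¬ cs.IsRightDescent v (if Even l then j else i) := by
    intro hd
    have hv' := hv
    rw [Nat.succ_eq_add_one, alternatingWord_succ', wordProd_cons, ← mul_assoc] at hv'
    have h₂ := cs.length_mul_wordProd_le
      (v * cs.simple (if Even l then j else i)) (alternatingWord i j l)
    rw [← hv', length_alternatingWord] at h₂
    rw [isRightDescent_iff] at hd
    omega
  have hvi : ¬ cs.IsRightDescent v i ∧ ¬ cs.IsRightDescent v j := by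
    by_cases he : Even l <;> simp_all [Nat.even_add_one]
  have hlt : cs.length v < cs.length w := by omega
  have hpi := ih _ hlt hvi.1 rfl
  have hpj := ih _ hlt hvi.2 rfl
  have hc₁ : 0 ≤ dihedralRootCoeff (M i j) (l + 1) := dihedralRootCoeff_nonneg (by omega)
  have hc₂ : 0 ≤ dihedralRootCoeff (M i j) (l + 1 + 1) := dihedralRootCoeff_nonneg (by omega)
  rw [hv, map_mul, LinearEquiv.mul_apply, cs.apply_wordProd_alternatingWord ρ α hρ hij]
  split_ifs <;> rw [map_add, map_smul, map_smul] <;>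
    exact add_nonneg (smul_nonneg ‹_› ‹_›) (smul_nonneg ‹_› ‹_›)

theorem nonneg_apply_iff_not_isRightDescent (hα : ∀ i, 0 < α i)
    (hρ : ∀ i j, ρ (cs.simple i) (α j) = α j + (2 * cos (π / M i j)) • α i) (w : W) (i : B) :
    0 ≤ ρ w (α i) ↔ ¬ cs.IsRightDescent w i := by
  refine ⟨fun h hd ↦ ?_,
    cs.nonneg_apply_of_not_isRightDescent ρ α (fun i ↦ (hα i).le) hρ⟩
  have hneg := cs.nonneg_apply_of_not_isRightDescent ρ α (fun i ↦ (hα i).le) hρ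
    (cs.isRightDescent_iff_not_isRightDescent_mul.1 hd)
  have hself : ρ (cs.simple i) (α i) = -α i := by
    rw [hρ, M.diagonal]
    simp
    module
  rw [map_mul, LinearEquiv.mul_apply, hself, map_neg, Left.nonneg_neg_iff] at hneg
  have h0 : ρ w (α i) = 0 := le_antisymm hneg h
  exact (hα i).ne' ((ρ w).map_eq_zero_iff.1 h0)

end Positivity

end CoxeterSystem

namespace CoxeterMatrix

open Real Module Polynomial.Chebyshev

theorem reflection_mul_reflection_pow_eq_one {V : Type*} [AddCommGroup V] [Module ℝ V]
    {x y : V} {f g : Dual ℝ V} (hf : f x = 2) (hg : g y = 2) {m : ℕ} (hm : 2 ≤ m)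
    (hfy : f y = -(2 * cos (π / m))) (hgx : g x = -(2 * cos (π / m))) :
    (reflection hf * reflection hg) ^ m = 1 := by
  obtain rfl | hm3 := hm.eq_or_lt
  · simp only [Nat.cast_ofNat, cos_pi_div_two, mul_zero, neg_zero] at hfy hgx
    ext z
    simp only [pow_two, LinearEquiv.mul_apply, reflection_apply, map_sub, map_smul, hf, hg, hfy,
      hgx, LinearEquiv.coe_one, id_eq]
    module
  set θ := π / m with hθ
  have hm' : (m : ℝ) ≠ 0 := by positivity
  have hmθ : m * θ = π := by rw [hθ]; field_simp
  have ht : 2 * cos (2 * θ) = f y * g x - 2 := by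
    rw [hfy, hgx, cos_two_mul]; ring
  have hsin : sin (2 * θ) ≠ 0 := by
    have h3 : (2 : ℝ) < m := by exact_mod_cast hm3
    apply (sin_pos_of_pos_of_lt_pi _ _).ne'
    · positivity
    · rw [← hmθ]
      have : 0 < θ := by positivity
      nlinarith
  have hS (n : ℤ) := S_two_mul_real_cos (2 * θ) n
  ext z
  rw [reflection_mul_reflection_pow_apply hf hg m z _ ht]
  obtain ⟨k, hk⟩ := Nat.even_or_odd' m
  obtain hk | hk := hk
  · have e₁ : ((m : ℤ) - 2) / 2 = k - 1 := by omega
    have e₂ : ((m : ℤ) - 1) / 2 = k - 1 := by omega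
    have hz : (S ℝ ((k : ℤ) - 1)).eval (2 * cos (2 * θ)) = 0 := by
      apply (mul_eq_zero.1 _).resolve_right hsin
      rw [hS]
      have : (((k : ℤ) - 1 : ℤ) + 1 : ℝ) * (2 * θ) = π := by
        rw [← hmθ, hk]; push_cast; ring
      rw [this, sin_pi]
    rw [e₁, e₂, hz]
    simp
  · have e₁ : ((m : ℤ) - 2) / 2 = k - 1 := by omega
    have e₂ : ((m : ℤ) - 1) / 2 = k := by omega
    have e₃ : ((m : ℤ) - 3) / 2 = k - 1 := by omega
    have e₄ : (m : ℤ) / 2 = k := by omega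
    have hz : (S ℝ (k : ℤ)).eval (2 * cos (2 * θ)) +
        (S ℝ ((k : ℤ) - 1)).eval (2 * cos (2 * θ)) = 0 := by
      apply (mul_eq_zero.1 _).resolve_right hsin
      rw [add_mul, hS, hS]
      have h₁ : (((k : ℤ) : ℝ) + 1) * (2 * θ) = θ + π := by
        rw [← hmθ, hk]; push_cast; ring
      have h₂ : (((k : ℤ) - 1 : ℤ) + 1 : ℝ) * (2 * θ) = π - θ := by
        rw [← hmθ, hk]; push_cast; ring
      rw [h₁, h₂, sin_add_pi, sin_pi_sub]
      ring
    rw [e₁, e₂, e₃, e₄, hz]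
    simp

variable {S : Type*} (M : CoxeterMatrix S)

/-- The coroot of a simple root in the geometric representation on `S →₀ ℝ`. -/
noncomputable def simpleCoroot (i : S) : Dual ℝ (S →₀ ℝ) :=
  Finsupp.linearCombination ℝ fun j ↦ -(2 * cos (π / M i j))

theorem simpleCoroot_single (i j : S) :
    M.simpleCoroot i (Finsupp.single j 1) = -(2 * cos (π / M i j)) := by
  simp [simpleCoroot]

theorem simpleCoroot_single_self (i : S) : M.simpleCoroot i (Finsupp.single i 1) = 2 := by
  simp [simpleCoroot_single]

theorem isLiftable_reflection :
    M.IsLiftable fun i ↦ reflection (M.simpleCoroot_single_self i) := by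
  intro i j
  obtain rfl | hij := eq_or_ne i j
  · rw [M.diagonal, pow_one]
    ext1 z
    exact involutive_reflection (M.simpleCoroot_single_self i) z
  by_cases h0 : M i j = 0
  · rw [h0, pow_zero]
  have h1 := M.off_diagonal i j hij
  apply reflection_mul_reflection_pow_eq_one _ _ (by omega) (M.simpleCoroot_single i j)
  rw [simpleCoroot_single, M.symmetric]

/-- The geometric representation of a Coxeter group. -/
noncomputable def geometricRep : M.Group →* ((S →₀ ℝ) ≃ₗ[ℝ] (S →₀ ℝ)) :=
  M.toCoxeterSystem.lift ⟨_, M.isLiftable_reflection⟩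

theorem geometricRep_simple_single (i j : S) :
    M.geometricRep (M.simple i) (Finsupp.single j 1) =
      Finsupp.single j 1 + (2 * cos (π / M i j)) • Finsupp.single i 1 := by
  rw [geometricRep, ← M.toCoxeterSystem_simple, CoxeterSystem.lift_apply_simple, reflection_apply,
    simpleCoroot_single]
  module

theorem isLiftable_restrict (X : Set S) : (M.restrict X).IsLiftable fun x ↦ M.simple x :=
  fun x y ↦ M.toCoxeterSystem.simple_mul_simple_pow x y

/-- The natural homomorphism from the Coxeter group of a full subgraph. -/
noncomputable def restrictHom (X : Set S) : (M.restrict X).Group →* M.Group :=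
  (M.restrict X).toCoxeterSystem.lift ⟨_, M.isLiftable_restrict X⟩

theorem restrictHom_simple (X : Set S) (x : X) :
    M.restrictHom X ((M.restrict X).simple x) = M.simple x := by
  rw [restrictHom, ← (M.restrict X).toCoxeterSystem_simple, CoxeterSystem.lift_apply_simple]

theorem isRightDescent_restrictHom_iff (X : Set S) (w : (M.restrict X).Group) (x : X) :
    M.toCoxeterSystem.IsRightDescent (M.restrictHom X w) x ↔
      (M.restrict X).toCoxeterSystem.IsRightDescent w x := by
  have hpos (i : S) : (0 : S →₀ ℝ) < Finsupp.single i 1 := by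
    refine lt_of_le_of_ne (by simp) ?_
    simp [eq_comm]
  have h₁ := M.toCoxeterSystem.nonneg_apply_iff_not_isRightDescent M.geometricRep
    (fun i ↦ Finsupp.single i 1) hpos M.geometricRep_simple_single (M.restrictHom X w) x
  have h₂ := (M.restrict X).toCoxeterSystem.nonneg_apply_iff_not_isRightDescent
    (M.geometricRep.comp (M.restrictHom X)) (fun i ↦ Finsupp.single i.1 1) (fun i ↦ hpos i)
    (fun i j ↦ by
      rw [MonoidHom.comp_apply, toCoxeterSystem_simple, restrictHom_simple]
      exact M.geometricRep_simple_single i j) w x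
  exact not_iff_not.1 (h₁.symm.trans h₂)

theorem length_restrictHom (X : Set S) (w : (M.restrict X).Group) :
    M.toCoxeterSystem.length (M.restrictHom X w) = (M.restrict X).toCoxeterSystem.length w := by
  induction w using (M.restrict X).toCoxeterSystem.simple_induction_right with
  | one => simp
  | mul_simple_right w x ih =>
    have hd := M.isRightDescent_restrictHom_iff X w x
    rw [map_mul, toCoxeterSystem_simple, restrictHom_simple]
    have h₁ := M.toCoxeterSystem.length_mul_simple (M.restrictHom X w) x
    have h₂ := (M.restrict X).toCoxeterSystem.length_mul_simple w x
    simp only [CoxeterSystem.IsRightDescent, toCoxeterSystem_simple] at hd h₁ h₂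
    omega

end CoxeterMatrix

/-- **Proposition 2.3.** The natural homomorphism `ι_X : W[Γ_X] → W[Γ]` mapping `x ↦ x` for
`x ∈ X` is injective and preserves word length. -/
theorem coxeter_parabolic_natural_embedding {S : Type*} [Fintype S] [DecidableEq S]
    (M : CoxeterMatrix S) (X : Set S) :
    ∃ φ : (M.restrict X).Group →* M.Group,
      (∀ x : X, φ ((M.restrict X).simple x) = M.simple ↑x) ∧
      Function.Injective φ ∧
      ∀ w : (M.restrict X).Group,
        (M.restrict X).toCoxeterSystem.length w = M.toCoxeterSystem.length (φ w) := by
  refine ⟨M.restrictHom X, M.restrictHom_simple X, ?_, fun w ↦ (M.length_restrictHom X w).symm⟩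
  rw [injective_iff_map_eq_one]
  intro w hw
  rw [← CoxeterSystem.length_eq_zero_iff (M.restrict X).toCoxeterSystem, ← M.length_restrictHom X,
    hw, CoxeterSystem.length_one]
end

section
/- Let Γ be a Coxeter graph with vertex set S and let X ⊆ S. The natural homomorphism ι_X : A[Γ_X] → A[Γ] mapping x to x for every x ∈ X is injective, and it preserves word length: ℓ_X(g) = ℓ_S(ι_X(g)) for every g ∈ A[Γ_X], where ℓ_X is word length in A[Γ_X] with respect to X ⊔ X^{-1} and ℓ_S is word length in A[Γ] with respect to S ⊔ S^{-1}. -/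
/-- The alternating product `a b a b ⋯` of length `m`. -/
def altProd {G : Type*} [Monoid G] (a b : G) (m : ℕ) : G :=
  ((List.range m).map (fun i => if i % 2 = 0 then a else b)).prod

/-- The defining (braid) relations of the Artin group of a Coxeter matrix `M`.
The value `M s t = 0` encodes `m_{s,t} = ∞`. -/
def artinRels {S : Type*} (M : CoxeterMatrix S) : Set (FreeGroup S) :=
  {r | ∃ s t : S, s ≠ t ∧ M s t ≠ 0 ∧
      r = altProd (FreeGroup.of s) (FreeGroup.of t) (M s t) *
        (altProd (FreeGroup.of t) (FreeGroup.of s) (M s t))⁻¹}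

/-- The Artin group `A[Γ]` of a Coxeter matrix. -/
def ArtinGroup {S : Type*} (M : CoxeterMatrix S) : Type _ :=
  PresentedGroup (artinRels M)

instance {S : Type*} (M : CoxeterMatrix S) : Group (ArtinGroup M) := by
  unfold ArtinGroup; infer_instance

/-- The standard generator of the Artin group corresponding to `s`. -/
def ArtinGroup.gen {S : Type*} (M : CoxeterMatrix S) (s : S) : ArtinGroup M :=
  PresentedGroup.of s

/-- Evaluation in `G` of a word over an alphabet `A` of generators together with formal
inverses: the letter `(a, true)` is the generator `gen a` and `(a, false)` is its inverse. -/
def evalWord {A G : Type*} [Group G] (gen : A → G) (w : List (A × Bool)) : G :=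
  (w.map fun p => if p.2 then gen p.1 else (gen p.1)⁻¹).prod

/-- The word length of `g ∈ G` with respect to the generating family `gen : A → G`
(and the inverses of the generators). -/
noncomputable def genWordLength {A G : Type*} [Group G] (gen : A → G) (g : G) : ℕ :=
  sInf {n | ∃ w : List (A × Bool), w.length = n ∧ evalWord gen w = g}

section DihedralRepresentation

open Polynomial.Chebyshev Module

/-- The entry `-2 cos (π / m)` of the Cartan matrix of a Coxeter matrix, which is `-2` for
`m = ∞` (encoded as `m = 0`). -/
noncomputable def CoxeterMatrix.cartan {B : Type*} (M : CoxeterMatrix B) (s t : B) : ℝ :=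
  -2 * Real.cos (Real.pi / M s t)

theorem CoxeterMatrix.cartan_self {B : Type*} (M : CoxeterMatrix B) (s : B) :
    M.cartan s s = 2 := by
  simp [CoxeterMatrix.cartan]

theorem CoxeterMatrix.cartan_comm {B : Type*} (M : CoxeterMatrix B) (s t : B) :
    M.cartan s t = M.cartan t s := by
  simp [CoxeterMatrix.cartan, M.symmetric s t]

theorem CoxeterMatrix.cartan_mul_sub_two {B : Type*} (M : CoxeterMatrix B) (s t : B) :
    M.cartan s t * M.cartan t s - 2 = 2 * Real.cos (2 * Real.pi / M s t) := by
  rw [M.cartan_comm t s, mul_div_assoc, Real.cos_two_mul, CoxeterMatrix.cartan]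
  ring

/-- The linear form defining the reflection of `s` in the geometric representation. -/
noncomputable def CoxeterMatrix.coroot {B : Type*} (M : CoxeterMatrix B) (s : B) :
    Dual ℝ (B →₀ ℝ) :=
  Finsupp.linearCombination ℝ (M.cartan s)

theorem CoxeterMatrix.coroot_single {B : Type*} (M : CoxeterMatrix B) (s t : B) :
    M.coroot s (Finsupp.single t 1) = M.cartan s t := by
  simp [CoxeterMatrix.coroot]

theorem CoxeterMatrix.coroot_single_self {B : Type*} (M : CoxeterMatrix B) (s : B) :
    M.coroot s (Finsupp.single s 1) = 2 := by
  rw [M.coroot_single, M.cartan_self]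

/-- The reflection of `s` in the geometric representation. -/
noncomputable def CoxeterMatrix.geometricReflection {B : Type*} (M : CoxeterMatrix B) (s : B) :
    (B →₀ ℝ) ≃ₗ[ℝ] (B →₀ ℝ) :=
  reflection (M.coroot_single_self s)

theorem sin_two_pi_div_ne_zero {m : ℕ} (hm : 3 ≤ m) : Real.sin (2 * Real.pi / m) ≠ 0 := by
  have hm' : (3 : ℝ) ≤ m := by exact_mod_cast hm
  apply ne_of_gt
  apply Real.sin_pos_of_pos_of_lt_pi
  · positivity
  · rw [div_lt_iff₀ (by linarith)]
    nlinarith [Real.pi_pos]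

theorem CoxeterMatrix.isLiftable_geometricReflection {B : Type*} (M : CoxeterMatrix B) :
    M.IsLiftable M.geometricReflection := by
  intro s t
  apply LinearEquiv.toLinearMap_injective
  have key := reflection_mul_reflection_pow (M.coroot_single_self s) (M.coroot_single_self t)
    (M s t) (2 * Real.cos (2 * Real.pi / M s t))
    (by rw [M.coroot_single, M.coroot_single, M.cartan_mul_sub_two])
  rw [CoxeterMatrix.geometricReflection, CoxeterMatrix.geometricReflection, key]
  obtain h | h | h | h : M s t = 0 ∨ M s t = 1 ∨ M s t = 2 ∨ 3 ≤ M s t := by omega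
  · rw [h]
    ext
    simp
  · obtain rfl : s = t := by
      by_contra hst
      exact M.off_diagonal s t hst h
    rw [← key, h, pow_one]
    ext1 a
    ext1
    exact involutive_reflection (M.coroot_single_self s) _
  · have h0 : M.cartan s t = 0 := by simp [CoxeterMatrix.cartan, h]
    have h1 : M.cartan t s = 0 := by rw [M.cartan_comm, h0]
    have hc : 2 * Real.cos (2 * Real.pi / (2 : ℕ)) = -2 := by simp
    rw [h, hc, M.coroot_single, M.coroot_single, h0, h1]
    norm_num
    ext
    simp
    ring
  · set θ : ℝ := 2 * Real.pi / M s t with hθ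
    have hs : Real.sin θ ≠ 0 := sin_two_pi_div_ne_zero h
    have hm : (M s t : ℝ) * θ = 2 * Real.pi := by
      rw [hθ]
      field_simp
    obtain ⟨k, hk | hk⟩ := Nat.even_or_odd' (M s t)
    · have hS : (S ℝ ((k : ℤ) - 1)).eval (2 * Real.cos θ) = 0 := by
        apply (mul_eq_zero.mp _).resolve_right hs
        rw [S_two_mul_real_cos]
        rw [hk] at hm
        push_cast at hm ⊢
        rw [sub_add_cancel, show (k : ℝ) * θ = Real.pi by linarith, Real.sin_pi]
      have e1 : ((M s t : ℤ) - 2) / 2 = k - 1 := by omega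
      have e2 : ((M s t : ℤ) - 1) / 2 = k - 1 := by omega
      rw [e1, e2, hS]
      ext
      simp
    · have hS : (S ℝ (k : ℤ)).eval (2 * Real.cos θ) +
          (S ℝ ((k : ℤ) - 1)).eval (2 * Real.cos θ) = 0 := by
        apply (mul_eq_zero.mp _).resolve_right hs
        rw [add_mul, S_two_mul_real_cos, S_two_mul_real_cos]
        rw [hk] at hm
        push_cast at hm ⊢
        rw [sub_add_cancel, show ((k : ℝ) + 1) * θ = 2 * Real.pi - k * θ by linarith,
          Real.sin_two_pi_sub]
        ring
      have e1 : ((M s t : ℤ) - 2) / 2 = k - 1 := by omega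
      have e2 : ((M s t : ℤ) - 1) / 2 = k := by omega
      have e3 : ((M s t : ℤ) - 3) / 2 = k - 1 := by omega
      have e4 : (M s t : ℤ) / 2 = k := by omega
      rw [e1, e2, e3, e4, hS]
      ext
      simp

theorem CoxeterMatrix.dvd_of_geometricReflection_pow_eq_one {B : Type*} (M : CoxeterMatrix B)
    {s t : B} {k : ℕ}
    (h : (M.geometricReflection s * M.geometricReflection t) ^ k = 1) : M s t ∣ k := by
  by_cases hst : s = t
  · subst hst
    simp
  have key := reflection_mul_reflection_pow_apply_self (M.coroot_single_self s)
    (M.coroot_single_self t)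
    k (2 * Real.cos (2 * Real.pi / M s t))
    (by rw [M.coroot_single, M.coroot_single, M.cartan_mul_sub_two])
  rw [← CoxeterMatrix.geometricReflection, ← CoxeterMatrix.geometricReflection, h,
    LinearEquiv.coe_one, id, M.coroot_single t s] at key
  have hx := DFunLike.congr_fun key s
  have hy := DFunLike.congr_fun key t
  simp only [Finsupp.add_apply, Finsupp.smul_apply, Finsupp.single_eq_same, smul_eq_mul,
    Finsupp.single_eq_of_ne hst, Finsupp.single_eq_of_ne (Ne.symm hst), mul_one, mul_zero, add_zero,
    zero_add] at hx hy
  obtain h0 | h0 | h0 | h0 : M s t = 0 ∨ M s t = 1 ∨ M s t = 2 ∨ 3 ≤ M s t := by omega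
  · simp [h0, CoxeterMatrix.cartan, M.symmetric t s] at hy ⊢
    exact hy
  · simp [h0]
  · have hc : 2 * Real.cos (2 * Real.pi / (2 : ℕ)) = -2 := by simp
    rw [h0, hc, S_eval_neg_two, S_eval_neg_two] at hx
    rw [h0]
    by_contra hk
    rw [← even_iff_two_dvd, Nat.not_even_iff_odd] at hk
    rw [Int.negOnePow_odd _ (by exact_mod_cast hk), Int.negOnePow_even _ (by
      rw [Int.even_sub_one, Int.not_even_iff_odd]
      exact_mod_cast hk)] at hx
    push_cast at hx
    linarith
  · set θ : ℝ := 2 * Real.pi / M s t with hθ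
    have hs : Real.sin θ ≠ 0 := sin_two_pi_div_ne_zero h0
    have hm : (M s t : ℝ) * θ = 2 * Real.pi := by
      rw [hθ]
      field_simp
    have hc : M.cartan t s ≠ 0 := by
      intro hc
      have h2 := M.cartan_mul_sub_two s t
      rw [hc, mul_zero, ← hθ] at h2
      have h3 := Real.sin_sq_add_cos_sq θ
      rw [show Real.cos θ = -1 by linarith] at h3
      exact hs (pow_eq_zero_iff two_ne_zero |>.mp (by linarith))
    have hS : (S ℝ ((k : ℤ) - 1)).eval (2 * Real.cos θ) = 0 := by
      simpa [hc, eq_comm] using hy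
    rw [hS, add_zero] at hx
    have h1 := S_two_mul_real_cos θ k
    have h2 := S_two_mul_real_cos θ (k - 1)
    rw [← hx, one_mul] at h1
    rw [hS, zero_mul] at h2
    push_cast at h1 h2
    rw [sub_add_cancel] at h2
    rw [add_mul, one_mul, Real.sin_add, ← h2, zero_mul, zero_add] at h1
    have hcos : Real.cos (k * θ) = 1 := mul_right_cancel₀ hs (by linarith)
    obtain ⟨n, hn⟩ := (Real.cos_eq_one_iff _).mp hcos
    rw [← hm] at hn
    have hθ0 : θ ≠ 0 := by
      rintro h3
      simp [h3] at hs
    have h4 : (n : ℝ) * M s t = k := mul_right_cancel₀ hθ0 (by linarith)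
    have h5 : n * (M s t : ℤ) = k := by exact_mod_cast h4
    exact Int.natCast_dvd_natCast.mp ⟨n, by linarith⟩

end DihedralRepresentation

namespace CoxeterSystem

variable {B W : Type*} [Group W] {M : CoxeterMatrix B} (cs : CoxeterSystem M W)

theorem orderOf_simple_mul_simple (s t : B) : orderOf (cs.simple s * cs.simple t) = M s t := by
  apply Nat.dvd_antisymm
  · exact orderOf_dvd_of_pow_eq_one (cs.simple_mul_simple_pow s t)
  · apply M.dvd_of_geometricReflection_pow_eq_one
    have h := congrArg (cs.lift ⟨_, M.isLiftable_geometricReflection⟩)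
      (pow_orderOf_eq_one (cs.simple s * cs.simple t))
    simpa only [map_pow, map_mul, map_one, cs.lift_apply_simple] using h

theorem simple_injective : Function.Injective cs.simple := by
  intro s t h
  by_contra hst
  have h1 := cs.orderOf_simple_mul_simple s t
  rw [h, cs.simple_mul_simple_self, orderOf_one] at h1
  exact M.off_diagonal s t hst h1.symm

open Classical in
/-- The simple reflection `s` acts on signed elements of `W` by conjugation, reversing the sign of
`s` itself. -/
noncomputable def signedConj (s : B) : Equiv.Perm (W × ZMod 2) :=
  Function.Involutive.toPerm
    (fun p => (cs.simple s * p.1 * cs.simple s, p.2 + if p.1 = cs.simple s then 1 else 0))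
    (by
      rintro ⟨r, e⟩
      have h : cs.simple s * r * cs.simple s = cs.simple s ↔ r = cs.simple s := by
        rw [mul_assoc, mul_eq_left, mul_eq_one_iff_eq_inv, cs.inv_simple]
      simp only [h]
      simp [mul_assoc, add_assoc, CharTwo.add_self_eq_zero])

open Classical in
theorem signedConj_apply (s : B) (r : W) (e : ZMod 2) :
    cs.signedConj s (r, e) =
      (cs.simple s * r * cs.simple s, e + if r = cs.simple s then 1 else 0) :=
  rfl

theorem simple_mul_simple_inv (s t : B) :
    (cs.simple s * cs.simple t)⁻¹ = cs.simple t * cs.simple s := by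
  rw [mul_inv_rev, cs.inv_simple, cs.inv_simple]

theorem simple_mul_pow_eq (s t : B) (n : ℕ) :
    cs.simple t * (cs.simple s * cs.simple t) ^ n =
      ((cs.simple s * cs.simple t) ^ n)⁻¹ * cs.simple t := by
  rw [← inv_pow, simple_mul_simple_inv]
  induction n with
  | zero => simp
  | succ n ih => rw [pow_succ', pow_succ', mul_assoc, mul_assoc, ih, mul_assoc]

open Classical in
theorem signedConj_mul_pow_apply (s t : B) (n : ℕ) (r : W) (e : ZMod 2) :
    ((cs.signedConj s * cs.signedConj t) ^ n) (r, e) =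
      ((cs.simple s * cs.simple t) ^ n * r * ((cs.simple s * cs.simple t) ^ n)⁻¹,
        e + ∑ j ∈ Finset.range (2 * n),
          if r = cs.simple t * (cs.simple s * cs.simple t) ^ j then 1 else 0) := by
  induction n with
  | zero => simp
  | succ n ih =>
    set c := cs.simple s * cs.simple t with hc
    have hcinv : c⁻¹ = cs.simple t * cs.simple s := cs.simple_mul_simple_inv s t
    have htc : ∀ n, cs.simple t * c ^ n = (c ^ n)⁻¹ * cs.simple t := cs.simple_mul_pow_eq s t
    have h1 : c ^ n * r * (c ^ n)⁻¹ = cs.simple t ↔ r = cs.simple t * c ^ (2 * n) := by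
      rw [mul_inv_eq_iff_eq_mul, ← eq_inv_mul_iff_mul_eq, ← mul_assoc, ← htc, mul_assoc, ← pow_add,
        two_mul]
    have h2 : cs.simple t * (c ^ n * r * (c ^ n)⁻¹) * cs.simple t = cs.simple s ↔
        r = cs.simple t * c ^ (2 * n + 1) := by
      have h3 : cs.simple t * (c ^ n * r * (c ^ n)⁻¹) * cs.simple t = cs.simple s ↔
          c ^ n * r * (c ^ n)⁻¹ = cs.simple t * c := by
        rw [← eq_mul_inv_iff_mul_eq, ← eq_inv_mul_iff_mul_eq, cs.inv_simple]
      rw [h3, mul_inv_eq_iff_eq_mul, ← eq_inv_mul_iff_mul_eq, mul_assoc, ← mul_assoc _⁻¹, ← htc,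
        mul_assoc, ← pow_succ', ← pow_add, two_mul, add_assoc]
    rw [pow_succ', Equiv.Perm.mul_apply, ih, Equiv.Perm.mul_apply, signedConj_apply,
      signedConj_apply, show 2 * (n + 1) = 2 * n + 1 + 1 by ring, Finset.sum_range_succ,
      Finset.sum_range_succ]
    simp only [h1, h2, add_assoc, pow_succ' c n, mul_inv_rev, hcinv]
    simp only [hc, mul_assoc]

theorem isLiftable_signedConj : M.IsLiftable cs.signedConj := by
  classical
  intro s t
  ext1 ⟨r, e⟩
  rw [signedConj_mul_pow_apply, cs.simple_mul_simple_pow, two_mul, Finset.sum_range_add]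
  simp [pow_add, CharTwo.add_self_eq_zero]

/-- The number modulo `2` of times that the path from `1` to `w` in the Cayley graph crosses the
wall of the reflection `r` (on the right). -/
noncomputable def inversionParity (w r : W) : ZMod 2 :=
  (cs.lift ⟨_, cs.isLiftable_signedConj⟩ w (r, 0)).2

theorem lift_signedConj_apply (w r : W) (e : ZMod 2) :
    cs.lift ⟨_, cs.isLiftable_signedConj⟩ w (r, e) =
      (w * r * w⁻¹, e + cs.inversionParity w r) := by
  induction w using cs.simple_induction_left generalizing r e with
  | one => simp [inversionParity]
  | mul_simple_left w i ih =>
    have h : ∀ e, cs.lift ⟨_, cs.isLiftable_signedConj⟩ (cs.simple i * w) (r, e) =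
        cs.signedConj i (w * r * w⁻¹, e + cs.inversionParity w r) := by
      intro e
      rw [map_mul, Equiv.Perm.mul_apply, ih, cs.lift_apply_simple]
    rw [inversionParity, h, h, signedConj_apply, signedConj_apply]
    simp [mul_assoc, add_assoc]

theorem inversionParity_one (r : W) : cs.inversionParity 1 r = 0 := by
  simp [inversionParity]

theorem inversionParity_mul (u v r : W) :
    cs.inversionParity (u * v) r =
      cs.inversionParity v r + cs.inversionParity u (v * r * v⁻¹) := by
  have h := cs.lift_signedConj_apply (u * v) r 0
  rw [map_mul, Equiv.Perm.mul_apply, lift_signedConj_apply, lift_signedConj_apply] at h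
  simpa using (congrArg Prod.snd h).symm

open Classical in
theorem inversionParity_simple (s : B) (r : W) :
    cs.inversionParity (cs.simple s) r = if r = cs.simple s then 1 else 0 := by
  rw [inversionParity, cs.lift_apply_simple, signedConj_apply, zero_add]

theorem inversionParity_simple_self (s : B) :
    cs.inversionParity (cs.simple s) (cs.simple s) = 1 := by
  simp [inversionParity_simple]

theorem inversionParity_inv_conj (w r : W) :
    cs.inversionParity w⁻¹ (w * r * w⁻¹) = cs.inversionParity w r := by
  have h := cs.inversionParity_mul w⁻¹ w r
  rw [inv_mul_cancel, inversionParity_one] at h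
  exact (CharTwo.add_eq_zero.mp h.symm).symm

/-- The exchange condition. -/
theorem exists_sublist_wordProd_eq_mul (ω : List B) {r : W}
    (h : cs.inversionParity (cs.wordProd ω) r ≠ 0) :
    ∃ ω' : List B, ω'.Sublist ω ∧ ω'.length + 1 = ω.length ∧
      cs.wordProd ω' = cs.wordProd ω * r := by
  classical
  induction ω with
  | nil => simp [inversionParity_one] at h
  | cons i ω ih =>
    rw [cs.wordProd_cons] at h
    by_cases hr : cs.wordProd ω * r * (cs.wordProd ω)⁻¹ = cs.simple i
    · refine ⟨ω, List.sublist_cons_self i ω, rfl, ?_⟩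
      rw [mul_inv_eq_iff_eq_mul] at hr
      rw [cs.wordProd_cons, mul_assoc, hr, cs.simple_mul_simple_cancel_left]
    · rw [inversionParity_mul, inversionParity_simple, if_neg hr, add_zero] at h
      obtain ⟨ω', h1, h2, h3⟩ := ih h
      exact ⟨i :: ω', h1.cons_cons i, by simp [h2], by
        rw [cs.wordProd_cons, cs.wordProd_cons, h3, mul_assoc]⟩

/-- The standard parabolic subgroup generated by a set of simple reflections. -/
def parabolic (Y : Set B) : Subgroup W := Subgroup.closure (cs.simple '' Y)

theorem simple_mem_parabolic {Y : Set B} {y : B} (hy : y ∈ Y) : cs.simple y ∈ cs.parabolic Y :=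
  Subgroup.subset_closure (Set.mem_image_of_mem _ hy)

theorem wordProd_mem_parabolic {Y : Set B} {ω : List B} (h : ∀ i ∈ ω, i ∈ Y) :
    cs.wordProd ω ∈ cs.parabolic Y := by
  apply Subgroup.list_prod_mem
  intro w hw
  obtain ⟨i, hi, rfl⟩ := List.mem_map.mp hw
  exact cs.simple_mem_parabolic (h i hi)

theorem exists_word_of_mem_parabolic {Y : Set B} {u : W} (hu : u ∈ cs.parabolic Y) :
    ∃ ω : List B, (∀ i ∈ ω, i ∈ Y) ∧ cs.wordProd ω = u := by
  induction hu using Subgroup.closure_induction with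
  | mem u hu =>
    obtain ⟨y, hy, rfl⟩ := hu
    exact ⟨[y], by simpa using hy, by simp⟩
  | one => exact ⟨[], by simp, by simp⟩
  | mul u v _ _ hu hv =>
    obtain ⟨ω, h1, rfl⟩ := hu
    obtain ⟨ω', h2, rfl⟩ := hv
    refine ⟨ω ++ ω', ?_, cs.wordProd_append ω ω'⟩
    intro i hi
    exact (List.mem_append.mp hi).elim (h1 i) (h2 i)
  | inv u _ hu =>
    obtain ⟨ω, h1, rfl⟩ := hu
    exact ⟨ω.reverse, fun i hi => h1 i (List.mem_reverse.mp hi), cs.wordProd_reverse ω⟩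

theorem eq_one_of_inversionParity_eq_zero {Y : Set B} {u : W} (hu : u ∈ cs.parabolic Y)
    (h : ∀ y ∈ Y, cs.inversionParity u (cs.simple y) = 0) : u = 1 := by
  obtain ⟨ω, hω, rfl⟩ := cs.exists_word_of_mem_parabolic hu
  clear hu
  induction hn : ω.length using Nat.strong_induction_on generalizing ω with
  | _ n ih =>
    rcases List.eq_nil_or_concat ω with rfl | ⟨ω', y, rfl⟩
    · simp
    · have hy : y ∈ Y := hω y (by simp)
      have h1 := h y hy
      rw [cs.wordProd_concat, inversionParity_mul, inversionParity_simple_self,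
        cs.inv_simple, cs.simple_mul_simple_cancel_right] at h1
      obtain ⟨ω'', h2, h3, h4⟩ := cs.exists_sublist_wordProd_eq_mul ω'
        (r := cs.simple y) (by intro h0; simp [h0] at h1)
      rw [← cs.wordProd_concat] at h4
      rw [← h4] at h ⊢
      refine ih ω''.length ?_ ω'' (fun i hi => hω i ?_) h rfl
      · simp only [List.concat_eq_append, List.length_append, List.length_singleton] at hn
        omega
      · simp [h2.subset hi]

theorem exists_minimal_mem_coset (Y : Set B) (w : W) :
    ∃ u ∈ cs.parabolic Y, ∃ d, w = u * d ∧
      ∀ r ∈ cs.parabolic Y, cs.inversionParity d⁻¹ r = 0 := by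
  let f : cs.parabolic Y → ℕ := fun u => cs.length ((u : W)⁻¹ * w)
  let u := Function.argmin f
  refine ⟨u, u.2, (u : W)⁻¹ * w, by group, fun r hr => ?_⟩
  by_contra hne
  obtain ⟨ω, hω, hωu⟩ := cs.exists_isReduced ((u : W)⁻¹ * w)⁻¹
  rw [hωu] at hne
  obtain ⟨ω', -, h1, h2⟩ := cs.exists_sublist_wordProd_eq_mul ω hne
  have h3 : f u ≤ f (u * ⟨r, hr⟩) := Function.argmin_le f _
  have h4 : f (u * ⟨r, hr⟩) = cs.length (cs.wordProd ω') := by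
    rw [h2, ← hωu, ← cs.length_inv]
    simp [f, mul_assoc]
  have h5 : f u = ω.length := by
    rw [← hω, ← hωu, cs.length_inv]
  have h6 := cs.length_wordProd_le ω'
  omega

/-- If `d` is the minimal representative of its coset, then the simple reflections conjugated by
`d⁻¹` from a standard parabolic subgroup come from simple reflections of this subgroup. -/
theorem exists_eq_simple_of_conj_eq_simple {Y : Set B} {d r : W} {x : B}
    (hd : ∀ r ∈ cs.parabolic Y, cs.inversionParity d⁻¹ r = 0) (hr : r ∈ cs.parabolic Y)
    (h : d⁻¹ * r * d = cs.simple x) : ∃ y ∈ Y, r = cs.simple y := by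
  by_contra! hne
  have hr1 : r = 1 := by
    apply cs.eq_one_of_inversionParity_eq_zero hr
    intro y hy
    have hy' := cs.simple_mem_parabolic hy
    have h1 : cs.inversionParity (cs.simple x) (d⁻¹ * cs.simple y * d) = 0 := by
      classical
      rw [inversionParity_simple, if_neg]
      rw [← h]
      intro h2
      exact hne y hy (mul_left_cancel (mul_right_cancel h2)).symm
    have h2 := cs.inversionParity_inv_conj d⁻¹ (cs.simple y)
    rw [hd _ hy', inv_inv] at h2
    rw [← h, inversionParity_mul, inversionParity_mul, h2, hd] at h1
    · simpa [mul_assoc] using h1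
    · have h3 : d * (d⁻¹ * cs.simple y * d) * d⁻¹ = cs.simple y := by group
      rw [h3]
      exact mul_mem (mul_mem hr hy') (inv_mem hr)
  rw [hr1, mul_one, inv_mul_cancel] at h
  have h3 := cs.inversionParity_simple_self x
  rw [← h, inversionParity_one] at h3
  exact zero_ne_one h3

end CoxeterSystem

/-- The alternating list `[a, b, a, b, ⋯]` of length `m`. -/
def altList {G : Type*} (a b : G) (m : ℕ) : List G :=
  (List.range m).map (fun i => if i % 2 = 0 then a else b)

theorem altList_succ {G : Type*} (a b : G) (m : ℕ) :
    altList a b (m + 1) = a :: altList b a m := by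
  simp only [altList, List.range_succ_eq_map, List.map_cons, List.map_map]
  congr 1
  apply List.map_congr_left
  intro i _
  rcases Nat.mod_two_eq_zero_or_one i with h | h <;> simp [Nat.succ_mod_two_eq_zero_iff, h]

theorem mem_altList {G : Type*} {a b c : G} {m : ℕ} (h : c ∈ altList a b m) : c = a ∨ c = b := by
  obtain ⟨i, -, rfl⟩ := List.mem_map.mp h
  split <;> simp

theorem prod_map_altList {A G : Type*} [Monoid G] (f : A → G) (a b : A) (m : ℕ) :
    ((altList a b m).map f).prod = altProd (f a) (f b) m := by
  simp only [altList, altProd, List.map_map]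
  congr 2
  ext i
  exact apply_ite f _ _ _

theorem altProd_succ {G : Type*} [Monoid G] (a b : G) (m : ℕ) :
    altProd a b (m + 1) = a * altProd b a m := by
  have h := prod_map_altList (id : G → G)
  simp only [List.map_id, id] at h
  rw [← h, altList_succ, List.prod_cons, h]

theorem altProd_zero {G : Type*} [Monoid G] (a b : G) : altProd a b 0 = 1 := rfl

theorem map_altProd {G H : Type*} [Monoid G] [Monoid H] (f : G →* H) (a b : G) (m : ℕ) :
    f (altProd a b m) = altProd (f a) (f b) m := by
  induction m generalizing a b with
  | zero => simp [altProd_zero]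
  | succ m ih => rw [altProd_succ, altProd_succ, map_mul, ih]

namespace CoxeterSystem

variable {B W : Type*} [Group W] {M : CoxeterMatrix B} (cs : CoxeterSystem M W)

theorem wordProd_altList (s t : B) (m : ℕ) :
    cs.wordProd (altList s t m) = altProd (cs.simple s) (cs.simple t) m :=
  prod_map_altList _ _ _ _

theorem altProd_simple_eq_pow_mul (s t : B) (m : ℕ) :
    altProd (cs.simple s) (cs.simple t) m =
      (cs.simple s * cs.simple t) ^ m * altProd (cs.simple t) (cs.simple s) m := by
  induction m generalizing s t with
  | zero => simp [altProd_zero]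
  | succ m ih =>
    rw [altProd_succ, altProd_succ, ih t s, ← mul_assoc, ← mul_pow_mul, pow_succ]
    simp only [mul_assoc, cs.simple_mul_simple_cancel_left]

theorem wordProd_altList_comm (s t : B) :
    cs.wordProd (altList s t (M s t)) = cs.wordProd (altList t s (M s t)) := by
  rw [wordProd_altList, wordProd_altList, altProd_simple_eq_pow_mul, cs.simple_mul_simple_pow,
    one_mul]

theorem rightInvSeq_altList (s t : B) (m : ℕ) :
    cs.rightInvSeq (altList s t m) = (List.range m).map fun j =>
      (cs.wordProd (altList s t m))⁻¹ * ((cs.simple s * cs.simple t) ^ j * cs.simple s) *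
        cs.wordProd (altList s t m) := by
  induction m generalizing s t with
  | zero => rfl
  | succ m ih =>
    rw [altList_succ, rightInvSeq, ih, List.range_succ_eq_map, List.map_cons, List.map_map,
      cs.wordProd_cons]
    congr 1
    · simp [mul_assoc]
    · apply List.map_congr_left
      intro j _
      have h : cs.simple s * ((cs.simple s * cs.simple t) ^ (j + 1) * cs.simple s) * cs.simple s =
          (cs.simple t * cs.simple s) ^ j * cs.simple t := by
        rw [pow_succ']
        simp only [mul_assoc, cs.simple_mul_simple_cancel_left, cs.simple_mul_simple_self, mul_one]
        rw [mul_pow_mul]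
      rw [Function.comp_apply, Nat.succ_eq_add_one, ← h, mul_inv_rev, cs.inv_simple]
      simp only [mul_assoc]

theorem rightInvSeq_altList_comm (s t : B) :
    cs.rightInvSeq (altList t s (M s t)) = (cs.rightInvSeq (altList s t (M s t))).reverse := by
  rw [rightInvSeq_altList, rightInvSeq_altList, wordProd_altList_comm]
  apply List.ext_getElem
  · simp
  · intro j h1 h2
    simp only [List.length_map, List.length_range] at h1
    simp only [List.getElem_map, List.getElem_range, List.getElem_reverse, List.length_map,
      List.length_range]
    have h3 : (cs.simple s * cs.simple t) ^ j *
        ((cs.simple s * cs.simple t) ^ (M s t - 1 - j) * cs.simple s) = cs.simple t := by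
      rw [← mul_assoc, ← pow_add, show j + (M s t - 1 - j) = M s t - 1 by lia,
        ← mul_inv_cancel_right (_ ^ _) (cs.simple s * cs.simple t), ← pow_succ,
        show M s t - 1 + 1 = M s t by lia, cs.simple_mul_simple_pow, one_mul,
        cs.simple_mul_simple_inv, cs.simple_mul_simple_cancel_right]
    rw [← cs.simple_mul_simple_inv s t, inv_pow, inv_mul_eq_iff_eq_mul.mpr h3.symm]

/-- The minimal representatives of the cosets `w W_X`. -/
abbrev MinimalRep (X : Set B) : Type _ :=
  {w : W // ∀ x ∈ X, cs.inversionParity w (cs.simple x) = 0}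

section Fold

variable {H : Type*} [Group H] {X : Set B} (h : X → H)

theorem inversionParity_simple_mul_of_forall_ne {w : W}
    (hw : ∀ x ∈ X, cs.inversionParity w (cs.simple x) = 0) {s : B}
    (hs : ¬ ∃ x : X, w⁻¹ * cs.simple s * w = cs.simple x) :
    ∀ x ∈ X, cs.inversionParity (cs.simple s * w) (cs.simple x) = 0 := by
  classical
  intro x hx
  rw [inversionParity_mul, hw x hx, zero_add, inversionParity_simple, if_neg]
  intro h1
  refine hs ⟨⟨x, hx⟩, ?_⟩
  rw [← h1]
  group

theorem conj_simple_mul_self (s : B) (w : W) :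
    (cs.simple s * w)⁻¹ * cs.simple s * (cs.simple s * w) = w⁻¹ * cs.simple s * w := by
  simp [mul_assoc]

open Classical in
/-- The action of a simple generator `s` on pairs `(w, g)`: if `s w` is minimal in its coset of
`W_X`, then `w` moves to `s w`; otherwise `s w = w x` for some `x` in `X`, and `x` acts on `g`. -/
noncomputable def fold (s : B) : Equiv.Perm (cs.MinimalRep X × H) where
  toFun p :=
    if hs : ∃ x : X, p.1.1⁻¹ * cs.simple s * p.1.1 = cs.simple x then (p.1, h hs.choose * p.2)
    else (⟨cs.simple s * p.1.1, cs.inversionParity_simple_mul_of_forall_ne p.1.2 hs⟩, p.2)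
  invFun p :=
    if hs : ∃ x : X, p.1.1⁻¹ * cs.simple s * p.1.1 = cs.simple x then (p.1, (h hs.choose)⁻¹ * p.2)
    else (⟨cs.simple s * p.1.1, cs.inversionParity_simple_mul_of_forall_ne p.1.2 hs⟩, p.2)
  left_inv := by
    rintro ⟨⟨w, hw⟩, g⟩
    by_cases hs : ∃ x : X, w⁻¹ * cs.simple s * w = cs.simple x
    · simp [hs]
    · simp only [hs, dif_neg, not_false_eq_true, conj_simple_mul_self,
        cs.simple_mul_simple_cancel_left]
  right_inv := by
    rintro ⟨⟨w, hw⟩, g⟩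
    by_cases hs : ∃ x : X, w⁻¹ * cs.simple s * w = cs.simple x
    · simp [hs]
    · simp only [hs, dif_neg, not_false_eq_true, conj_simple_mul_self,
        cs.simple_mul_simple_cancel_left]

theorem fold_of_eq {s : B} {p : cs.MinimalRep X × H} {x : X}
    (hx : p.1.1⁻¹ * cs.simple s * p.1.1 = cs.simple x) : cs.fold h s p = (p.1, h x * p.2) := by
  have hs : ∃ x : X, p.1.1⁻¹ * cs.simple s * p.1.1 = cs.simple x := ⟨x, hx⟩
  have hxs : hs.choose = x :=
    Subtype.ext (cs.simple_injective (hs.choose_spec.symm.trans hx))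
  rw [← hxs]
  exact dif_pos hs

theorem fold_of_forall_ne {s : B} {p : cs.MinimalRep X × H}
    (hs : ¬ ∃ x : X, p.1.1⁻¹ * cs.simple s * p.1.1 = cs.simple x) :
    cs.fold h s p =
      (⟨cs.simple s * p.1.1, cs.inversionParity_simple_mul_of_forall_ne p.1.2 hs⟩, p.2) :=
  dif_neg hs

theorem fold_symm_eq_or (s : B) (p : cs.MinimalRep X × H) :
    ((cs.fold h s).symm p).2 = p.2 ∨ ∃ x, ((cs.fold h s).symm p).2 = (h x)⁻¹ * p.2 := by
  by_cases hs : ∃ x : X, p.1.1⁻¹ * cs.simple s * p.1.1 = cs.simple x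
  · right
    exact ⟨hs.choose, congrArg Prod.snd (dif_pos hs)⟩
  · left
    have h1 : (cs.fold h s).symm p =
        (⟨cs.simple s * p.1.1, cs.inversionParity_simple_mul_of_forall_ne p.1.2 hs⟩, p.2) :=
      dif_neg hs
    rw [h1]

theorem fold_eq_or (s : B) (p : cs.MinimalRep X × H) :
    (cs.fold h s p).2 = p.2 ∨ ∃ x, (cs.fold h s p).2 = h x * p.2 := by
  by_cases hs : ∃ x : X, p.1.1⁻¹ * cs.simple s * p.1.1 = cs.simple x
  · obtain ⟨x, hx⟩ := hs
    exact Or.inr ⟨x, by rw [cs.fold_of_eq h hx]⟩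
  · exact Or.inl (by rw [cs.fold_of_forall_ne h hs])

/-- If the coset `W_Y d` contains no `v` with `y v = v x`, then words in `Y` act on it by
multiplication. -/
theorem prod_map_fold_of_forall_ne {Y : Set B} {d : W}
    (hd : ∀ u ∈ cs.parabolic Y, ∀ y ∈ Y, ∀ x ∈ X,
      (u * d)⁻¹ * cs.simple y * (u * d) ≠ cs.simple x)
    {ω : List B} (hω : ∀ i ∈ ω, i ∈ Y) {u : W} (hu : u ∈ cs.parabolic Y)
    {p : cs.MinimalRep X × H} (hp : p.1.1 = u * d) :
    ((ω.map (cs.fold h)).prod p).1.1 = cs.wordProd ω * p.1.1 ∧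
      ((ω.map (cs.fold h)).prod p).2 = p.2 := by
  induction ω with
  | nil => simp
  | cons i ω ih =>
    have hω' : ∀ j ∈ ω, j ∈ Y := fun j hj => hω j (List.mem_cons_of_mem i hj)
    obtain ⟨h1, h2⟩ := ih hω'
    rw [List.map_cons, List.prod_cons, Equiv.Perm.mul_apply, cs.fold_of_forall_ne h]
    · exact ⟨by simp only [h1, cs.wordProd_cons, mul_assoc], h2⟩
    · rintro ⟨x, hx⟩
      have h3 : ((ω.map (cs.fold h)).prod p).1.1 = cs.wordProd ω * u * d := by
        rw [h1, hp, mul_assoc]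
      rw [h3] at hx
      exact hd _ (mul_mem (cs.wordProd_mem_parabolic hω') hu) i (hω i List.mem_cons_self) x x.2 hx

open Classical in
/-- If all equalities `y v = v x` with `v` in the coset `W_Y d` involve the same `x`, then words
in `Y` act by multiplication and by powers of `x`. -/
theorem prod_map_fold_of_forall_eq {Y : Set B} {d : W} {y₀ : B} {x₀ : X} (hy₀ : y₀ ∈ Y)
    (hx₀ : d⁻¹ * cs.simple y₀ * d = cs.simple x₀)
    (hd : ∀ u ∈ cs.parabolic Y, ∀ y ∈ Y, ∀ x : X,
      (u * d)⁻¹ * cs.simple y * (u * d) = cs.simple x → x = x₀)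
    {ω : List B} (hω : ∀ i ∈ ω, i ∈ Y) {u : W} (hu : u ∈ cs.parabolic Y)
    {p : cs.MinimalRep X × H} (hp : p.1.1 = u * d) {n : ℕ}
    (hn : n = (cs.rightInvSeq ω).count (p.1.1 * cs.simple x₀ * p.1.1⁻¹)) :
    ((ω.map (cs.fold h)).prod p).1.1 = cs.wordProd ω * p.1.1 * (cs.simple x₀ ^ n)⁻¹ ∧
      ((ω.map (cs.fold h)).prod p).2 = h x₀ ^ n * p.2 := by
  induction ω generalizing n with
  | nil => simp [hn]
  | cons i ω ih =>
    have hω' : ∀ j ∈ ω, j ∈ Y := fun j hj => hω j (List.mem_cons_of_mem i hj)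
    obtain ⟨h1, h2⟩ := ih hω' rfl
    rw [rightInvSeq, List.count_cons] at hn
    set k := (cs.rightInvSeq ω).count (p.1.1 * cs.simple x₀ * p.1.1⁻¹) with hk
    set q := (ω.map (cs.fold h)).prod p with hq
    have hmem : ∃ v ∈ cs.parabolic Y, q.1.1 = v * d := by
      refine ⟨cs.wordProd ω * u * (cs.simple y₀ ^ k)⁻¹,
        mul_mem (mul_mem (cs.wordProd_mem_parabolic hω') hu)
          (inv_mem (pow_mem (cs.simple_mem_parabolic hy₀) k)), ?_⟩
      have h3 : cs.simple x₀ ^ k = d⁻¹ * cs.simple y₀ ^ k * d := by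
        have h4 := conj_pow (a := d⁻¹) (b := cs.simple y₀) (i := k)
        rwa [inv_inv, hx₀] at h4
      rw [h1, hp, h3]
      group
    have hiff : q.1.1⁻¹ * cs.simple i * q.1.1 = cs.simple x₀ ↔
        (cs.wordProd ω)⁻¹ * cs.simple i * cs.wordProd ω = p.1.1 * cs.simple x₀ * p.1.1⁻¹ := by
      have h4 : cs.wordProd ω = q.1.1 * cs.simple x₀ ^ k * p.1.1⁻¹ := by
        rw [h1]
        group
      rw [h4, show (q.1.1 * cs.simple x₀ ^ k * p.1.1⁻¹)⁻¹ * cs.simple i *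
          (q.1.1 * cs.simple x₀ ^ k * p.1.1⁻¹) = p.1.1 * ((cs.simple x₀ ^ k)⁻¹ *
            (q.1.1⁻¹ * cs.simple i * q.1.1) * cs.simple x₀ ^ k) * p.1.1⁻¹ by group,
        mul_left_inj, mul_right_inj]
      generalize q.1.1⁻¹ * cs.simple i * q.1.1 = r
      refine ⟨fun h5 => by rw [h5]; group, fun h5 => ?_⟩
      calc r = cs.simple x₀ ^ k * ((cs.simple x₀ ^ k)⁻¹ * r * cs.simple x₀ ^ k) *
            (cs.simple x₀ ^ k)⁻¹ := by group
        _ = cs.simple x₀ := by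
          rw [h5]
          group
    rw [List.map_cons, List.prod_cons, Equiv.Perm.mul_apply, ← hq, cs.wordProd_cons]
    by_cases hs : q.1.1⁻¹ * cs.simple i * q.1.1 = cs.simple x₀
    · rw [if_pos (by simpa using hiff.mp hs)] at hn
      rw [cs.fold_of_eq h hs, hn]
      refine ⟨?_, by rw [h2, pow_succ', mul_assoc]⟩
      have h5 : q.1.1 = cs.simple i * q.1.1 * (cs.simple x₀)⁻¹ := by
        rw [← hs]
        group
      rw [h5, h1, pow_succ']
      simp [mul_assoc]
    · rw [if_neg (by simpa using fun h6 => hs (hiff.mpr h6)), add_zero] at hn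
      rw [cs.fold_of_forall_ne h, hn]
      · exact ⟨by simp only [h1, mul_assoc], h2⟩
      · rintro ⟨x, hx⟩
        obtain ⟨v, hv, hvd⟩ := hmem
        have h7 := hx
        rw [hvd] at h7
        rw [hd v hv i (hω i List.mem_cons_self) x h7] at hx
        exact hs hx

theorem altProd_fold_of_eq {s t : B} {p : cs.MinimalRep X × H} {x y : X}
    (hx : p.1.1⁻¹ * cs.simple s * p.1.1 = cs.simple x)
    (hy : p.1.1⁻¹ * cs.simple t * p.1.1 = cs.simple y) (m : ℕ) :
    altProd (cs.fold h s) (cs.fold h t) m p = (p.1, altProd (h x) (h y) m * p.2) := by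
  induction m generalizing s t x y with
  | zero => simp [altProd_zero]
  | succ m ih =>
    rw [altProd_succ, altProd_succ, Equiv.Perm.mul_apply, ih hy hx]
    rw [cs.fold_of_eq h (p := (p.1, altProd (h y) (h x) m * p.2)) hx, mul_assoc]

theorem altProd_fold_comm
    (hh : ∀ x y : X, M x y ≠ 0 → altProd (h x) (h y) (M x y) = altProd (h y) (h x) (M x y))
    {s t : B} (hst : M s t ≠ 0) :
    altProd (cs.fold h s) (cs.fold h t) (M s t) = altProd (cs.fold h t) (cs.fold h s) (M s t) := by
  classical
  ext1 p
  set Y : Set B := {s, t} with hY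
  have hsY : s ∈ Y := by simp [hY]
  have htY : t ∈ Y := by simp [hY]
  obtain ⟨u, hu, d, hp, hd⟩ := cs.exists_minimal_mem_coset Y p.1.1
  have hω : ∀ i ∈ altList s t (M s t), i ∈ Y := fun i hi => mem_altList hi
  have hω' : ∀ i ∈ altList t s (M s t), i ∈ Y := fun i hi => (mem_altList hi).symm
  have hconj : ∀ v ∈ cs.parabolic Y, ∀ y ∈ Y, ∀ x : X,
      (v * d)⁻¹ * cs.simple y * (v * d) = cs.simple x →
        ∃ y ∈ Y, d⁻¹ * cs.simple y * d = cs.simple x := by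
    intro v hv y hy x hx
    have hx' : d⁻¹ * (v⁻¹ * cs.simple y * v) * d = cs.simple x := by
      rw [← hx]
      group
    obtain ⟨y', hy', h1⟩ := cs.exists_eq_simple_of_conj_eq_simple hd
      (mul_mem (mul_mem (inv_mem hv) (cs.simple_mem_parabolic hy)) hv) hx'
    exact ⟨y', hy', by rw [← h1, hx']⟩
  have hone : ∀ (y₀ : B), y₀ ∈ Y → ∀ x₀ : X, d⁻¹ * cs.simple y₀ * d = cs.simple x₀ →
      (∀ y ∈ Y, ∀ x : X, d⁻¹ * cs.simple y * d = cs.simple x → x = x₀) →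
      altProd (cs.fold h s) (cs.fold h t) (M s t) p =
        altProd (cs.fold h t) (cs.fold h s) (M s t) p := by
    intro y₀ hy₀ x₀ hx₀ hall
    have hall' : ∀ v ∈ cs.parabolic Y, ∀ y ∈ Y, ∀ x : X,
        (v * d)⁻¹ * cs.simple y * (v * d) = cs.simple x → x = x₀ := by
      intro v hv y hy x hx
      obtain ⟨y', hy', h1⟩ := hconj v hv y hy x hx
      exact hall y' hy' x h1
    rw [← prod_map_altList, ← prod_map_altList]
    obtain ⟨h1, h2⟩ := cs.prod_map_fold_of_forall_eq h hy₀ hx₀ hall' hω hu hp rfl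
    obtain ⟨h3, h4⟩ := cs.prod_map_fold_of_forall_eq h hy₀ hx₀ hall' hω' hu hp rfl
    rw [rightInvSeq_altList_comm, List.count_reverse] at h3 h4
    refine Prod.ext (Subtype.ext ?_) ?_
    · rw [h1, h3, wordProd_altList_comm]
    · rw [h2, h4]
  by_cases hs : ∃ x : X, d⁻¹ * cs.simple s * d = cs.simple x
  · obtain ⟨x, hx⟩ := hs
    by_cases ht : ∃ x : X, d⁻¹ * cs.simple t * d = cs.simple x
    · obtain ⟨y, hy⟩ := ht
      have hvanish : ∀ r ∈ Y, ∀ z : X, d⁻¹ * cs.simple r * d = cs.simple z →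
          cs.inversionParity u (cs.simple r) = 0 := by
        intro r hr z hz
        have h1 := p.1.2 z z.2
        have h2 := cs.inversionParity_inv_conj d⁻¹ (cs.simple r)
        rw [hd _ (cs.simple_mem_parabolic hr), inv_inv, hz] at h2
        rw [hp, inversionParity_mul, h2, zero_add, ← hz] at h1
        rw [← h1]
        congr 1
        group
      have hu1 : u = 1 := by
        apply cs.eq_one_of_inversionParity_eq_zero hu
        rintro r (rfl | rfl)
        · exact hvanish _ hsY x hx
        · exact hvanish _ htY y hy
      rw [hu1, one_mul] at hp
      have hM : M s t = M x y := by
        rw [← cs.orderOf_simple_mul_simple, ← cs.orderOf_simple_mul_simple, ← hx, ← hy,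
          show d⁻¹ * cs.simple s * d * (d⁻¹ * cs.simple t * d) =
            MulAut.conj d⁻¹ (cs.simple s * cs.simple t) by simp [mul_assoc]]
        exact (orderOf_injective (MulAut.conj d⁻¹).toMonoidHom (MulAut.conj d⁻¹).injective _).symm
      rw [cs.altProd_fold_of_eq h (hp ▸ hx) (hp ▸ hy), cs.altProd_fold_of_eq h (hp ▸ hy) (hp ▸ hx),
        hM, hh x y (hM ▸ hst)]
    · refine hone s hsY x hx ?_
      rintro y (rfl | rfl) z hz
      · exact Subtype.ext (cs.simple_injective (hz.symm.trans hx))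
      · exact absurd ⟨z, hz⟩ ht
  · by_cases ht : ∃ x : X, d⁻¹ * cs.simple t * d = cs.simple x
    · obtain ⟨x, hx⟩ := ht
      refine hone t htY x hx ?_
      rintro y (rfl | rfl) z hz
      · exact absurd ⟨z, hz⟩ hs
      · exact Subtype.ext (cs.simple_injective (hz.symm.trans hx))
    · have hnone : ∀ v ∈ cs.parabolic Y, ∀ y ∈ Y, ∀ x ∈ X,
          (v * d)⁻¹ * cs.simple y * (v * d) ≠ cs.simple x := by
        intro v hv y hy x hxX hx
        obtain ⟨y', rfl | rfl, h1⟩ := hconj v hv y hy ⟨x, hxX⟩ hx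
        · exact hs ⟨_, h1⟩
        · exact ht ⟨_, h1⟩
      rw [← prod_map_altList, ← prod_map_altList]
      obtain ⟨h1, h2⟩ := cs.prod_map_fold_of_forall_ne h hnone hω hu hp
      obtain ⟨h3, h4⟩ := cs.prod_map_fold_of_forall_ne h hnone hω' hu hp
      refine Prod.ext (Subtype.ext ?_) ?_
      · rw [h1, h3, wordProd_altList_comm]
      · rw [h2, h4]

end Fold

end CoxeterSystem

section WordLength

variable {A G : Type*} [Group G] (gen : A → G)

theorem evalWord_nil : evalWord gen [] = 1 := rfl

theorem evalWord_cons (a : A × Bool) (ω : List (A × Bool)) :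
    evalWord gen (a :: ω) = (if a.2 then gen a.1 else (gen a.1)⁻¹) * evalWord gen ω :=
  List.prod_cons

theorem genWordLength_evalWord_le (ω : List (A × Bool)) :
    genWordLength gen (evalWord gen ω) ≤ ω.length :=
  Nat.sInf_le ⟨ω, rfl, rfl⟩

variable {gen}

theorem exists_evalWord_eq (hgen : Subgroup.closure (Set.range gen) = ⊤) (g : G) :
    ∃ ω, evalWord gen ω = g := by
  have hg : g ∈ Subgroup.closure (Set.range gen) := hgen ▸ Subgroup.mem_top g
  induction hg using Subgroup.closure_induction_left with
  | one => exact ⟨[], rfl⟩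
  | mul_left x hx y _ ih =>
    obtain ⟨a, rfl⟩ := hx
    obtain ⟨ω, rfl⟩ := ih
    exact ⟨(a, true) :: ω, evalWord_cons _ _ _⟩
  | inv_mul_cancel x hx y _ ih =>
    obtain ⟨a, rfl⟩ := hx
    obtain ⟨ω, rfl⟩ := ih
    exact ⟨(a, false) :: ω, evalWord_cons _ _ _⟩

theorem exists_evalWord_eq_length_eq (hgen : Subgroup.closure (Set.range gen) = ⊤) (g : G) :
    ∃ ω, evalWord gen ω = g ∧ ω.length = genWordLength gen g := by
  obtain ⟨ω, h⟩ := exists_evalWord_eq hgen g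
  obtain ⟨ω', h1, h2⟩ := Nat.sInf_mem (s := {n | ∃ w : List (A × Bool), w.length = n ∧
    evalWord gen w = g}) ⟨_, ω, rfl, h⟩
  exact ⟨ω', h2, h1⟩

theorem map_evalWord {H : Type*} [Group H] (f : G →* H) (ω : List (A × Bool)) :
    f (evalWord gen ω) = evalWord (fun a => f (gen a)) ω := by
  induction ω with
  | nil => exact map_one f
  | cons a ω ih => rw [evalWord_cons, evalWord_cons, map_mul, ih, apply_ite f, map_inv]

end WordLength

namespace ArtinGroup

variable {S : Type*} (M : CoxeterMatrix S)

theorem closure_range_gen : Subgroup.closure (Set.range (gen M)) = ⊤ :=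
  PresentedGroup.closure_range_of _

theorem altProd_gen_comm (s t : S) (h : M s t ≠ 0) :
    altProd (gen M s) (gen M t) (M s t) = altProd (gen M t) (gen M s) (M s t) := by
  rcases eq_or_ne s t with rfl | hst
  · rfl
  have h1 : PresentedGroup.mk (artinRels M) (altProd (FreeGroup.of s) (FreeGroup.of t) (M s t) *
      (altProd (FreeGroup.of t) (FreeGroup.of s) (M s t))⁻¹) = 1 :=
    PresentedGroup.one_of_mem ⟨s, t, hst, h, rfl⟩
  rw [map_mul, map_inv, map_altProd, map_altProd] at h1
  exact mul_inv_eq_one.mp h1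

variable {M} {G : Type*} [Group G] {f : S → G}

theorem lift_artinRels_eq_one
    (hf : ∀ s t, M s t ≠ 0 → altProd (f s) (f t) (M s t) = altProd (f t) (f s) (M s t)) :
    ∀ r ∈ artinRels M, FreeGroup.lift f r = 1 := by
  rintro _ ⟨s, t, -, hst, rfl⟩
  rw [map_mul, map_inv, map_altProd, map_altProd, FreeGroup.lift_apply_of, FreeGroup.lift_apply_of,
    hf s t hst, mul_inv_cancel]

/-- The homomorphism from an Artin group determined by a family satisfying the braid relations. -/
def lift (hf : ∀ s t, M s t ≠ 0 → altProd (f s) (f t) (M s t) = altProd (f t) (f s) (M s t)) :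
    ArtinGroup M →* G :=
  PresentedGroup.toGroup (lift_artinRels_eq_one hf)

theorem lift_gen
    (hf : ∀ s t, M s t ≠ 0 → altProd (f s) (f t) (M s t) = altProd (f t) (f s) (M s t)) (s : S) :
    lift hf (gen M s) = f s :=
  PresentedGroup.toGroup.of _

variable (M) (X : Set S)

/-- The natural homomorphism from the Artin group of a full subgraph. -/
def parabolicHom : ArtinGroup (M.restrict X) →* ArtinGroup M :=
  lift (f := fun x : X => gen M x) fun x y h => altProd_gen_comm M x y h

theorem parabolicHom_gen (x : X) : parabolicHom M X (gen (M.restrict X) x) = gen M x :=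
  lift_gen _ x

/-- The action of the Artin group on pairs of a minimal representative and an element of the
Artin group of a full subgraph. -/
noncomputable def foldHom : ArtinGroup M →*
    Equiv.Perm (M.toCoxeterSystem.MinimalRep X × ArtinGroup (M.restrict X)) :=
  lift (f := M.toCoxeterSystem.fold (gen (M.restrict X))) fun _ _ hst =>
    M.toCoxeterSystem.altProd_fold_comm _ (fun x y h => altProd_gen_comm (M.restrict X) x y h) hst

theorem foldHom_gen (s : S) :
    foldHom M X (gen M s) = M.toCoxeterSystem.fold (gen (M.restrict X)) s :=
  lift_gen _ s

theorem foldHom_parabolicHom_apply (k g : ArtinGroup (M.restrict X)) :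
    foldHom M X (parabolicHom M X k) (⟨1, fun _ _ => CoxeterSystem.inversionParity_one _ _⟩, g) =
      (⟨1, fun _ _ => CoxeterSystem.inversionParity_one _ _⟩, k * g) := by
  have hgen : ∀ (x : X) (g : ArtinGroup (M.restrict X)),
      foldHom M X (gen M x) (⟨1, fun _ _ => CoxeterSystem.inversionParity_one _ _⟩, g) =
        (⟨1, fun _ _ => CoxeterSystem.inversionParity_one _ _⟩, gen (M.restrict X) x * g) := by
    intro x g
    rw [foldHom_gen]
    exact M.toCoxeterSystem.fold_of_eq _ (by simp)
  have hk : k ∈ Subgroup.closure (Set.range (gen (M.restrict X))) :=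
    closure_range_gen (M.restrict X) ▸ Subgroup.mem_top k
  induction hk using Subgroup.closure_induction_left with
  | one => rw [map_one, map_one, Equiv.Perm.one_apply, one_mul]
  | mul_left x hx y _ ih =>
    obtain ⟨x, rfl⟩ := hx
    rw [map_mul, map_mul, Equiv.Perm.mul_apply, ih, parabolicHom_gen, hgen, mul_assoc]
  | inv_mul_cancel x hx y _ ih =>
    obtain ⟨x, rfl⟩ := hx
    rw [map_mul, map_mul, Equiv.Perm.mul_apply, ih, map_inv, map_inv, parabolicHom_gen,
      Equiv.Perm.inv_eq_iff_eq, hgen, mul_assoc, mul_inv_cancel_left]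

theorem parabolicHom_injective : Function.Injective (parabolicHom M X) := by
  intro g k h
  have h1 := foldHom_parabolicHom_apply M X g 1
  rw [h, foldHom_parabolicHom_apply, mul_one, mul_one] at h1
  exact (congrArg Prod.snd h1).symm

theorem exists_foldHom_evalWord_apply_snd (ω : List (S × Bool))
    (p : M.toCoxeterSystem.MinimalRep X × ArtinGroup (M.restrict X)) :
    ∃ ω' : List (X × Bool), ω'.length ≤ ω.length ∧
      (foldHom M X (evalWord (gen M) ω) p).2 = evalWord (gen (M.restrict X)) ω' * p.2 := by
  induction ω with
  | nil => exact ⟨[], le_rfl, by simp [evalWord_nil]⟩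
  | cons a ω ih =>
    obtain ⟨s, b⟩ := a
    obtain ⟨ω', hlen, h⟩ := ih
    set q := foldHom M X (evalWord (gen M) ω) p with hq
    have key : (foldHom M X (evalWord (gen M) ((s, b) :: ω)) p).2 = q.2 ∨
        ∃ x, (foldHom M X (evalWord (gen M) ((s, b) :: ω)) p).2 =
          (if b then gen (M.restrict X) x else (gen (M.restrict X) x)⁻¹) * q.2 := by
      rw [evalWord_cons, map_mul, Equiv.Perm.mul_apply, ← hq]
      cases b with
      | true =>
        simp only [if_true, foldHom_gen]
        exact M.toCoxeterSystem.fold_eq_or _ s q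
      | false =>
        simp only [Bool.false_eq_true, if_false, map_inv, foldHom_gen]
        exact M.toCoxeterSystem.fold_symm_eq_or _ s q
    rcases key with h1 | ⟨x, h1⟩
    · exact ⟨ω', hlen.trans (Nat.le_succ _), h1.trans h⟩
    · exact ⟨(x, b) :: ω', Nat.succ_le_succ hlen, by rw [h1, h, evalWord_cons, mul_assoc]⟩

theorem genWordLength_parabolicHom (g : ArtinGroup (M.restrict X)) :
    genWordLength (gen M) (parabolicHom M X g) = genWordLength (gen (M.restrict X)) g := by
  apply le_antisymm
  · obtain ⟨ω, rfl, hω⟩ := exists_evalWord_eq_length_eq (closure_range_gen (M.restrict X)) g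
    have h : parabolicHom M X (evalWord (gen (M.restrict X)) ω) =
        evalWord (gen M) (ω.map (Prod.map (↑) id)) := by
      rw [map_evalWord]
      simp only [parabolicHom_gen, evalWord, List.map_map]
      rfl
    rw [← hω, h]
    exact (genWordLength_evalWord_le _ _).trans_eq (List.length_map _)
  · obtain ⟨ω, h, hω⟩ := exists_evalWord_eq_length_eq (closure_range_gen M) (parabolicHom M X g)
    obtain ⟨ω', hlen, h1⟩ := exists_foldHom_evalWord_apply_snd M X ω
      (⟨1, fun _ _ => CoxeterSystem.inversionParity_one _ _⟩, 1)
    rw [h, foldHom_parabolicHom_apply, mul_one, mul_one] at h1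
    rw [← hω, show g = _ from h1]
    exact (genWordLength_evalWord_le _ _).trans hlen

end ArtinGroup

/-- **Proposition 2.11.** The natural homomorphism `ι_X : A[Γ_X] → A[Γ]` mapping `x ↦ x` for
`x ∈ X` is injective and preserves word length (with respect to `X ⊔ X⁻¹` and `S ⊔ S⁻¹`). -/
theorem artin_parabolic_natural_embedding {S : Type*} [Fintype S] [DecidableEq S]
    (M : CoxeterMatrix S) (X : Set S) :
    ∃ φ : ArtinGroup (M.restrict X) →* ArtinGroup M,
      (∀ x : X, φ (ArtinGroup.gen (M.restrict X) x) = ArtinGroup.gen M ↑x) ∧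
      Function.Injective φ ∧
      ∀ g : ArtinGroup (M.restrict X),
        genWordLength (ArtinGroup.gen (M.restrict X)) g = genWordLength (ArtinGroup.gen M) (φ g) := by
  exact ⟨ArtinGroup.parabolicHom M X, ArtinGroup.parabolicHom_gen M X,
    ArtinGroup.parabolicHom_injective M X,
    fun g => (ArtinGroup.genWordLength_parabolicHom M X g).symm⟩
end
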